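/- Let K ⊂ ℝ^N be a convex body with center of mass M_K, circumcenter C_K (center of the smallest ball containing K), and I_M the center of mass (with respect to the Hausdorff measure of the appropriate dimension) of the set of incenters M(K) = {x ∈ K : dist(x, ∂K) = r_K}. Then diam(♥(K)) ≥ max(|M_K − C_K|, |C_K − I_M|, |I_M − M_K|). -/

import Mathlib

open MeasureTheory Set Metric
open scoped RealInnerProductSpace ENNReal NNReal

noncomputable section

/-- Reflection of `x` across the hyperplane `{z : ⟪z, ω⟫ = l}` (for a unit vector `ω`). -/
def reflectH {N : ℕ} (l : ℝ) (ω x : EuclideanSpace ℝ (Fin N)) : EuclideanSpace ℝ (Fin N) :=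
  x + (2 * (l - ⟪x, ω⟫)) • ω

/-- The maximal folding function of a set `K`:
`R_K(ω) = inf {l : the reflection of K ∩ {⟪·,ω⟫ ≥ l} across {⟪·,ω⟫ = l} lies in K}`. -/
def foldingFn {N : ℕ} (K : Set (EuclideanSpace ℝ (Fin N))) (ω : EuclideanSpace ℝ (Fin N)) : ℝ :=
  sInf {l : ℝ | reflectH l ω '' {x ∈ K | l ≤ ⟪x, ω⟫} ⊆ K}

/-- The heart of a set `K`. -/
def heart {N : ℕ} (K : Set (EuclideanSpace ℝ (Fin N))) : Set (EuclideanSpace ℝ (Fin N)) :=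
  {x ∈ K | ∀ ω : EuclideanSpace ℝ (Fin N), ‖ω‖ = 1 → ⟪x, ω⟫ ≤ foldingFn K ω}

/-- The center of mass of `K` (w.r.t. Lebesgue measure). -/
def centerOfMass {N : ℕ} (K : Set (EuclideanSpace ℝ (Fin N))) : EuclideanSpace ℝ (Fin N) :=
  (volume K).toReal⁻¹ • ∫ y in K, y

/-- The set of incenters of `K` with inradius `r`: points of `K` at distance `r`
from the boundary of `K`. -/
def incenterSet {N : ℕ} (K : Set (EuclideanSpace ℝ (Fin N))) (r : ℝ) :
    Set (EuclideanSpace ℝ (Fin N)) :=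
  {x ∈ K | Metric.infDist x (frontier K) = r}

/-- The center of mass of the incenter set, with respect to the Hausdorff measure of the
appropriate (affine) dimension. -/
def incenterMass {N : ℕ} (K : Set (EuclideanSpace ℝ (Fin N))) (r : ℝ) (k : ℕ) :
    EuclideanSpace ℝ (Fin N) :=
  ((μH[(k : ℝ)] (incenterSet K r)).toReal)⁻¹ • ∫ y in incenterSet K r, y ∂(μH[(k : ℝ)])

section Folding

variable {N : ℕ} {K : Set (EuclideanSpace ℝ (Fin N))} {l r : ℝ}
  {ω : EuclideanSpace ℝ (Fin N)}

/-- `K` folds at level `l` in direction `ω`: the reflection of the cap of `K` above the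
hyperplane lies in `K`. -/
def FoldsAt (K : Set (EuclideanSpace ℝ (Fin N))) (l : ℝ) (ω : EuclideanSpace ℝ (Fin N)) : Prop :=
  reflectH l ω '' {x ∈ K | l ≤ ⟪x, ω⟫} ⊆ K

lemma FoldsAt.reflectH_mem (h : FoldsAt K l ω) {x : EuclideanSpace ℝ (Fin N)} (hx : x ∈ K)
    (hl : l ≤ ⟪x, ω⟫) : reflectH l ω x ∈ K :=
  h ⟨x, ⟨hx, hl⟩, rfl⟩

lemma inner_reflectH (hω : ‖ω‖ = 1) (x : EuclideanSpace ℝ (Fin N)) :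
    ⟪reflectH l ω x, ω⟫ = 2 * l - ⟪x, ω⟫ := by
  rw [reflectH, inner_add_left, inner_smul_left, real_inner_self_eq_norm_sq, hω]
  simp
  ring

lemma reflectH_reflectH (hω : ‖ω‖ = 1) (x : EuclideanSpace ℝ (Fin N)) :
    reflectH l ω (reflectH l ω x) = x := by
  rw [reflectH, inner_reflectH hω, reflectH, add_assoc, ← add_smul]
  ring_nf
  simp

lemma dist_sq_reflectH_left (hω : ‖ω‖ = 1) (x y : EuclideanSpace ℝ (Fin N)) :
    dist (reflectH l ω x) y ^ 2 = dist x y ^ 2 + 4 * ((l - ⟪x, ω⟫) * (l - ⟪y, ω⟫)) := by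
  have h : reflectH l ω x - y = (x - y) + (2 * (l - ⟪x, ω⟫)) • ω := by
    rw [reflectH]
    abel
  rw [dist_eq_norm, dist_eq_norm, h, norm_add_sq_real, inner_smul_right, norm_smul, hω,
    inner_sub_left, mul_one, Real.norm_eq_abs, sq_abs]
  ring

lemma dist_reflectH_reflectH (hω : ‖ω‖ = 1) (x y : EuclideanSpace ℝ (Fin N)) :
    dist (reflectH l ω x) (reflectH l ω y) = dist x y := by
  rw [← sq_eq_sq₀ dist_nonneg dist_nonneg, dist_sq_reflectH_left hω, dist_comm x,
    dist_sq_reflectH_left hω, inner_reflectH hω, dist_comm y]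
  ring

lemma dist_le_dist_reflectH (hω : ‖ω‖ = 1) {x y : EuclideanSpace ℝ (Fin N)}
    (h : 0 ≤ (l - ⟪x, ω⟫) * (l - ⟪y, ω⟫)) : dist x y ≤ dist (reflectH l ω x) y := by
  rw [← sq_le_sq₀ dist_nonneg dist_nonneg, dist_sq_reflectH_left hω]
  linarith

/-- `reflectH l ω` as an isometric self-equivalence. -/
def reflectHEquiv (l : ℝ) (hω : ‖ω‖ = 1) :
    EuclideanSpace ℝ (Fin N) ≃ᵢ EuclideanSpace ℝ (Fin N) where
  toFun := reflectH l ω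
  invFun := reflectH l ω
  left_inv := reflectH_reflectH hω
  right_inv := reflectH_reflectH hω
  isometry_toFun := Isometry.of_dist_eq (dist_reflectH_reflectH hω)

lemma measurePreserving_hausdorffMeasure_reflectH (l : ℝ) (hω : ‖ω‖ = 1) (d : ℝ) :
    MeasurePreserving (reflectH l ω) (μH[d]) (μH[d]) :=
  (reflectHEquiv l hω).measurePreserving_hausdorffMeasure d

lemma measurePreserving_volume_reflectH (l : ℝ) (hω : ‖ω‖ = 1) :
    MeasurePreserving (reflectH l ω) volume volume := by
  have := isAddHaarMeasure_hausdorffMeasure (E := EuclideanSpace ℝ (Fin N))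
  rw [Measure.isAddLeftInvariant_eq_smul (volume : Measure (EuclideanSpace ℝ (Fin N)))
    (μH[Module.finrank ℝ (EuclideanSpace ℝ (Fin N))])]
  exact (measurePreserving_hausdorffMeasure_reflectH l hω _).smul_measure _

/-- The average of a foldable set with respect to a reflection-invariant measure lies below the
folding hyperplane. -/
lemma FoldsAt.inner_average_le {μ : Measure (EuclideanSpace ℝ (Fin N))} (h : FoldsAt K l ω)
    (hω : ‖ω‖ = 1) (hK : IsCompact K) (h0 : μ K ≠ 0) (htop : μ K ≠ ∞)
    (hμ : MeasurePreserving (reflectH l ω) μ μ) :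
    ⟪⨍ y in K, y ∂μ, ω⟫ ≤ l := by
  have hfin : Fact (μ K < ∞) := ⟨htop.lt_top⟩
  have hid : IntegrableOn (fun y : EuclideanSpace ℝ (Fin N) ↦ y) K μ :=
    continuousOn_id.integrableOn_of_subset_isCompact hK hK.measurableSet subset_rfl htop
  set f : EuclideanSpace ℝ (Fin N) → ℝ := fun y ↦ ⟪y, ω⟫ - l with hf
  have hfi : Integrable (K.indicator f) μ :=
    (integrable_indicator_iff hK.measurableSet).2 ((hid.inner_const ω).sub (integrable_const l))
  have hemb : MeasurableEmbedding (reflectH l ω) :=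
    (reflectHEquiv l hω).toHomeomorph.measurableEmbedding
  have hneg : ∫ y, K.indicator f y ∂μ ≤ 0 := by
    have hcomp := hμ.integral_comp hemb (K.indicator f)
    have hsum : ∫ y, K.indicator f y + K.indicator f (reflectH l ω y) ∂μ ≤ 0 := by
      refine integral_nonpos fun y ↦ ?_
      have hfy : f (reflectH l ω y) = -f y := by
        simp only [hf, inner_reflectH hω]
        ring
      by_cases h₁ : y ∈ K <;> by_cases h₂ : reflectH l ω y ∈ K <;>
        simp only [h₁, h₂, indicator_of_mem, indicator_of_notMem, not_false_eq_true, hfy,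
          Pi.zero_apply]
      · simp
      · by_contra! hlt
        exact h₂ (h.reflectH_mem h₁ (by simp only [hf] at hlt; linarith))
      · by_contra! hlt
        refine h₁ (reflectH_reflectH (l := l) hω y ▸ h.reflectH_mem h₂ ?_)
        rw [inner_reflectH hω]
        simp only [hf] at hlt
        linarith
      · simp
    have hadd := integral_add hfi ((hμ.integrable_comp_emb hemb).2 hfi)
    simp only [Function.comp_apply] at hadd
    rw [hadd, hcomp] at hsum
    linarith
  rw [integral_indicator hK.measurableSet, integral_sub (hid.inner_const ω) (integrable_const l)]
    at hneg
  have hpos : 0 < μ.real K := ENNReal.toReal_pos h0 htop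
  have hinner : ∫ y in K, ⟪y, ω⟫ ∂μ = ⟪∫ y in K, y ∂μ, ω⟫ := by
    simp only [real_inner_comm ω]
    exact integral_inner hid ω
  rw [hinner, setIntegral_const, smul_eq_mul] at hneg
  rw [setAverage_eq, inner_smul_left, RCLike.conj_to_real, inv_mul_le_iff₀ hpos]
  linarith

lemma setAverage_mem_of_isCompact {μ : Measure (EuclideanSpace ℝ (Fin N))}
    (hconv : Convex ℝ K) (hK : IsCompact K) (h0 : μ K ≠ 0) (htop : μ K ≠ ∞) :
    (⨍ y in K, y ∂μ) ∈ K :=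
  hconv.set_average_mem hK.isClosed h0 htop (ae_restrict_mem hK.measurableSet)
    (continuousOn_id.integrableOn_of_subset_isCompact hK hK.measurableSet subset_rfl htop)

/-- Membership in the heart can be tested on all hyperplanes at which `K` folds. -/
lemma mem_heart_of_forall_foldsAt (hK : IsCompact K) {x : EuclideanSpace ℝ (Fin N)} (hx : x ∈ K)
    (h : ∀ (l : ℝ) (ω : EuclideanSpace ℝ (Fin N)), ‖ω‖ = 1 → FoldsAt K l ω → ⟪x, ω⟫ ≤ l) :
    x ∈ heart K := by
  refine ⟨hx, fun ω hω ↦ le_csInf ?_ fun l hl ↦ h l ω hω hl⟩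
  obtain ⟨b, hb⟩ := hK.bddAbove_image (f := fun y ↦ ⟪y, ω⟫) (by fun_prop)
  refine ⟨b + 1, ?_⟩
  rintro _ ⟨y, ⟨hy, hyl⟩, rfl⟩
  have := hb (mem_image_of_mem _ hy)
  linarith

lemma setAverage_mem_heart {μ : Measure (EuclideanSpace ℝ (Fin N))}
    {S : Set (EuclideanSpace ℝ (Fin N))} (hK : IsCompact K)
    (hSK : S ⊆ K) (hconv : Convex ℝ S) (hS : IsCompact S) (h0 : μ S ≠ 0) (htop : μ S ≠ ∞)
    (hμ : ∀ (l : ℝ) (ω : EuclideanSpace ℝ (Fin N)), ‖ω‖ = 1 →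
      MeasurePreserving (reflectH l ω) μ μ)
    (hfold : ∀ (l : ℝ) (ω : EuclideanSpace ℝ (Fin N)), ‖ω‖ = 1 → FoldsAt K l ω →
      FoldsAt S l ω) :
    (⨍ y in S, y ∂μ) ∈ heart K :=
  mem_heart_of_forall_foldsAt hK (hSK (setAverage_mem_of_isCompact hconv hS h0 htop))
    fun l ω hω h ↦ (hfold l ω hω h).inner_average_le hω hS h0 htop (hμ l ω hω)

lemma centerOfMass_mem_heart (hK : IsCompact K) (hconv : Convex ℝ K)
    (hint : (interior K).Nonempty) : centerOfMass K ∈ heart K := by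
  have h0 : volume K ≠ 0 := (Measure.measure_pos_of_nonempty_interior _ hint).ne'
  have := setAverage_mem_heart hK subset_rfl hconv hK h0 hK.measure_ne_top
    (fun l _ ↦ measurePreserving_volume_reflectH l) (fun _ _ _ h ↦ h)
  rwa [setAverage_eq] at this

lemma circumcenter_mem_heart (hK : IsCompact K) (hconv : Convex ℝ K) (hne : K.Nonempty)
    {C : EuclideanSpace ℝ (Fin N)} {R : ℝ} (hball : K ⊆ closedBall C R)
    (huniq : ∀ C' : EuclideanSpace ℝ (Fin N), K ⊆ closedBall C' R → C' = C) :
    C ∈ heart K := by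
  refine mem_heart_of_forall_foldsAt hK ?_ fun l ω hω h ↦ ?_
  · obtain ⟨p, hp, hmin⟩ := exists_norm_eq_iInf_of_complete_convex hne hK.isComplete hconv C
    rw [norm_eq_iInf_iff_real_inner_le_zero hconv hp] at hmin
    suffices hpC : p = C from hpC ▸ hp
    refine huniq p fun x hx ↦ (le_trans ?_ (hball hx) : dist x p ≤ R)
    have hx' := hmin x hx
    have hsplit : x - C = (x - p) - (C - p) := by abel
    rw [← sq_le_sq₀ dist_nonneg dist_nonneg, dist_eq_norm, dist_eq_norm, hsplit,
      norm_sub_sq_real (x - p), real_inner_comm]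
    nlinarith [sq_nonneg ‖C - p‖]
  · by_contra! hlt
    have hC : reflectH l ω C = C := by
      refine huniq _ fun x hx ↦ ?_
      rw [mem_closedBall]
      by_cases hxl : l ≤ ⟪x, ω⟫
      · rw [← dist_reflectH_reflectH (l := l) hω, reflectH_reflectH hω]
        exact hball (h.reflectH_mem hx hxl)
      · push Not at hxl
        refine le_trans ?_ (hball hx)
        rw [dist_comm, dist_comm x, ← sq_le_sq₀ dist_nonneg dist_nonneg, dist_sq_reflectH_left hω]
        nlinarith
    have := inner_reflectH (l := l) hω C
    rw [hC] at this
    linarith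

lemma incenterSet_subset : incenterSet K r ⊆ K := fun _ hx ↦ hx.1

lemma isCompact_incenterSet (hK : IsCompact K) : IsCompact (incenterSet K r) :=
  hK.inter_right (isClosed_singleton.preimage (continuous_infDist_pt (frontier K)) :
    IsClosed {x | infDist x (frontier K) = r})

lemma ball_subset_of_mem_incenterSet (hK : IsClosed K) {x : EuclideanSpace ℝ (Fin N)}
    (hx : x ∈ incenterSet K r) : ball x r ⊆ K := by
  rcases le_or_gt r 0 with hr | hr
  · simp [ball_eq_empty.2 hr]
  have hdisj : Disjoint (ball x r) (frontier K) := hx.2 ▸ disjoint_ball_infDist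
  have hcover : ball x r ⊆ interior K ∪ Kᶜ := fun y hy ↦ by
    by_cases hyK : y ∈ K
    · left
      by_contra hyi
      exact hdisj.notMem_of_mem_left hy ⟨subset_closure hyK, hyi⟩
    · exact Or.inr hyK
  have hxi : x ∈ interior K := by
    rcases hcover (mem_ball_self hr) with h | h
    exacts [h, (h hx.1).elim]
  exact ((convex_ball x r).isPreconnected.subset_left_of_subset_union isOpen_interior
    hK.isOpen_compl (disjoint_compl_right.mono_left interior_subset) hcover
    ⟨x, mem_ball_self hr, hxi⟩).trans interior_subset

lemma mem_incenterSet_iff_ball_subset (hK : IsClosed K) (hfr : (frontier K).Nonempty)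
    (hr : ∀ x ∈ K, infDist x (frontier K) ≤ r) {x : EuclideanSpace ℝ (Fin N)} (hx : x ∈ K) :
    x ∈ incenterSet K r ↔ ball x r ⊆ K := by
  refine ⟨ball_subset_of_mem_incenterSet hK, fun h ↦ ⟨hx, (hr x hx).antisymm ?_⟩⟩
  refine (le_infDist hfr).2 fun {y} hy ↦ ?_
  by_contra! hlt
  exact hy.2 (interior_maximal h isOpen_ball (mem_ball'.2 hlt))

lemma convex_incenterSet (hK : IsClosed K) (hconv : Convex ℝ K) (hfr : (frontier K).Nonempty)
    (hr : ∀ x ∈ K, infDist x (frontier K) ≤ r) : Convex ℝ (incenterSet K r) := by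
  intro x hx y hy a b ha hb hab
  have hxy : a • x + b • y ∈ K := hconv hx.1 hy.1 ha hb hab
  rw [mem_incenterSet_iff_ball_subset hK hfr hr hxy]
  intro z hz
  obtain ⟨v, rfl⟩ : ∃ v, z = a • x + b • y + v := ⟨z - (a • x + b • y), by abel⟩
  have hv : ‖v‖ < r := by simpa using hz
  have hshift : a • x + b • y + v = a • (x + v) + b • (y + v) := by
    rw [smul_add, smul_add, add_add_add_comm, ← add_smul, hab, one_smul]
  rw [hshift]
  exact hconv (ball_subset_of_mem_incenterSet hK hx (by simpa using hv))
    (ball_subset_of_mem_incenterSet hK hy (by simpa using hv)) ha hb hab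

lemma FoldsAt.incenterSet (h : FoldsAt K l ω) (hω : ‖ω‖ = 1) (hK : IsClosed K)
    (hfr : (frontier K).Nonempty) (hr : ∀ x ∈ K, infDist x (frontier K) ≤ r) :
    FoldsAt (incenterSet K r) l ω := by
  rintro _ ⟨x, ⟨hx, hxl⟩, rfl⟩
  rw [mem_incenterSet_iff_ball_subset hK hfr hr (h.reflectH_mem hx.1 hxl)]
  have hxK := ball_subset_of_mem_incenterSet hK hx
  intro y hy
  rw [mem_ball, dist_comm] at hy
  rcases le_or_gt ⟪y, ω⟫ l with hyl | hyl
  · rw [← reflectH_reflectH (l := l) hω y]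
    refine h.reflectH_mem (hxK ?_) ?_
    · rwa [mem_ball, dist_comm, ← dist_reflectH_reflectH (l := l) hω, reflectH_reflectH hω]
    · rw [inner_reflectH hω]
      linarith
  · refine hxK (mem_ball'.2 (lt_of_le_of_lt (dist_le_dist_reflectH hω ?_) hy))
    nlinarith

end Folding

/-- A nonempty compact convex set has positive and finite Hausdorff measure in the dimension of
its affine span. -/
lemma Convex.hausdorffMeasure_finrank_ne_zero_ne_top {E : Type*} [NormedAddCommGroup E]
    [InnerProductSpace ℝ E] [FiniteDimensional ℝ E] [MeasurableSpace E] [BorelSpace E]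
    {S : Set E} (hconv : Convex ℝ S) (hS : IsCompact S) (hne : S.Nonempty) :
    μH[Module.finrank ℝ (affineSpan ℝ S).direction] S ≠ 0 ∧
      μH[Module.finrank ℝ (affineSpan ℝ S).direction] S ≠ ∞ := by
  obtain ⟨p, hp⟩ := hne
  have hpA : p ∈ affineSpan ℝ S := subset_affineSpan ℝ S hp
  have : Nonempty (affineSpan ℝ S) := ⟨⟨p, hpA⟩⟩
  set e : (affineSpan ℝ S).direction ≃ᵃⁱ[ℝ] affineSpan ℝ S :=
    AffineIsometryEquiv.vaddConst ℝ ⟨p, hpA⟩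
  have hcoe : Isometry (fun v ↦ (e v : E)) := isometry_subtype_coe.comp e.isometry
  have hrange : S ⊆ range (fun v ↦ (e v : E)) := fun x hx ↦
    ⟨e.symm ⟨x, subset_affineSpan ℝ S hx⟩, by simp⟩
  set S' : Set (affineSpan ℝ S).direction := (fun v ↦ (e v : E)) ⁻¹' S
  have himage : (fun v ↦ (e v : E)) '' S' = S := image_preimage_eq_of_subset hrange
  have hmeas : μH[Module.finrank ℝ (affineSpan ℝ S).direction] S =
      μH[Module.finrank ℝ (affineSpan ℝ S).direction] S' := by
    simpa only [himage] using hcoe.hausdorffMeasure_image (Or.inl (Nat.cast_nonneg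
      (Module.finrank ℝ (affineSpan ℝ S).direction))) S'
  have hcpt : IsCompact S' := hcoe.isClosedEmbedding.isCompact_preimage hS
  have hint : (interior S').Nonempty := by
    obtain ⟨_, y, hy, -⟩ := Set.Nonempty.intrinsicInterior hconv ⟨p, hp⟩
    refine ⟨e.symm y, ?_⟩
    have hS' : S' = e.toHomeomorph ⁻¹' ((↑) ⁻¹' S : Set (affineSpan ℝ S)) := rfl
    rw [hS', ← e.toHomeomorph.preimage_interior]
    simpa using hy
  rw [hmeas]
  exact ⟨(Measure.measure_pos_of_nonempty_interior _ hint).ne', hcpt.measure_ne_top⟩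

lemma incenterMass_mem_heart {N : ℕ} {K : Set (EuclideanSpace ℝ (Fin N))} {r : ℝ}
    (hK : IsCompact K) (hconv : Convex ℝ K) (hfr : (frontier K).Nonempty)
    (hr : ∀ x ∈ K, infDist x (frontier K) ≤ r) (hne : (incenterSet K r).Nonempty) :
    incenterMass K r (Module.finrank ℝ (affineSpan ℝ (incenterSet K r)).direction) ∈
      heart K := by
  have hSconv := convex_incenterSet hK.isClosed hconv hfr hr
  have hScpt : IsCompact (incenterSet K r) := isCompact_incenterSet hK
  obtain ⟨h0, htop⟩ := hSconv.hausdorffMeasure_finrank_ne_zero_ne_top hScpt hne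
  have := setAverage_mem_heart hK incenterSet_subset hSconv hScpt h0 htop
    (fun l _ hω ↦ measurePreserving_hausdorffMeasure_reflectH l hω _)
    (fun l ω hω h ↦ h.incenterSet hω hK.isClosed hfr hr)
  rwa [setAverage_eq] at this

/-- The diameter of the heart is at least the largest of the mutual distances between the
center of mass, the circumcenter, and the center of mass of the incenter set. -/
theorem statement10 {N : ℕ} (K : Set (EuclideanSpace ℝ (Fin N)))
    (hKcpt : IsCompact K) (hKconv : Convex ℝ K) (hKint : (interior K).Nonempty)
    (C : EuclideanSpace ℝ (Fin N)) (R : ℝ)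
    (hball : K ⊆ closedBall C R)
    (hmin : ∀ (C' : EuclideanSpace ℝ (Fin N)) (R' : ℝ), K ⊆ closedBall C' R' → R ≤ R')
    (huniq : ∀ C' : EuclideanSpace ℝ (Fin N), K ⊆ closedBall C' R → C' = C)
    (r : ℝ) (hr₁ : ∀ x ∈ K, Metric.infDist x (frontier K) ≤ r)
    (hr₂ : ∃ x ∈ K, Metric.infDist x (frontier K) = r)
    (k : ℕ) (hdim : Module.finrank ℝ (affineSpan ℝ (incenterSet K r)).direction = k) :
    max (dist (centerOfMass K) C)
        (max (dist C (incenterMass K r k)) (dist (incenterMass K r k) (centerOfMass K)))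
      ≤ Metric.diam (heart K) := by
  subst hdim
  have hne : K.Nonempty := hKint.mono interior_subset
  rcases N.eq_zero_or_pos with rfl | hN
  · simp [Subsingleton.elim _ C, diam_nonneg]
  have : Nontrivial (EuclideanSpace ℝ (Fin N)) := by
    have : Nonempty (Fin N) := ⟨⟨0, hN⟩⟩
    infer_instance
  have hfr : (frontier K).Nonempty := nonempty_frontier_iff.2 ⟨hne, hKcpt.ne_univ⟩
  have hbdd : Bornology.IsBounded (heart K) := hKcpt.isBounded.subset fun _ hx ↦ hx.1
  have hM := centerOfMass_mem_heart hKcpt hKconv hKint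
  have hC := circumcenter_mem_heart hKcpt hKconv hne hball huniq
  have hI := incenterMass_mem_heart hKcpt hKconv hfr hr₁ hr₂
  exact max_le (dist_le_diam_of_mem hbdd hM hC)
    (max_le (dist_le_diam_of_mem hbdd hC hI) (dist_le_diam_of_mem hbdd hI hM))
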